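/- Let K be a field, let A, B, C, D, h be n×n matrices over K, and let M be the 2n×2n block matrix M = fromBlocks A B C D. If the matrix A + B·h is invertible, then the image of the graph subspace Γ_h = {(v, h·v) : v ∈ Kⁿ} under the linear map x ↦ M·x equals the graph subspace Γ_{h'} of the matrix h' = (C + D·h)·(A + B·h)⁻¹. -/

import Mathlib

open Matrix

/-- The graph of an `n × n` matrix `h`, namely `{(v, h·v) : v ∈ Kⁿ}`, as a linear map
`Kⁿ →ₗ Kⁿ × Kⁿ` (where `Kⁿ × Kⁿ` is modelled as `Fin n ⊕ Fin n → K`). -/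
def graphLin {K : Type*} [CommRing K] {n : ℕ} (h : Matrix (Fin n) (Fin n) K) :
    (Fin n → K) →ₗ[K] (Fin n ⊕ Fin n → K) where
  toFun v := Sum.elim v (h *ᵥ v)
  map_add' u v := by
    funext x
    cases x <;> simp [Matrix.mulVec_add]
  map_smul' c v := by
    funext x
    cases x <;> simp [Matrix.mulVec_smul]

/-- The graph subspace `Γ_h = {(v, h·v) : v ∈ Kⁿ} ⊆ Kⁿ × Kⁿ`. -/
def graphSubspace {K : Type*} [CommRing K] {n : ℕ} (h : Matrix (Fin n) (Fin n) K) :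
    Submodule K (Fin n ⊕ Fin n → K) :=
  LinearMap.range (graphLin h)

theorem fromBlocks_mulVec_graphLin {K : Type*} [CommRing K] {n : ℕ}
    (A B C D h : Matrix (Fin n) (Fin n) K) (v : Fin n → K) :
    Matrix.fromBlocks A B C D *ᵥ graphLin h v =
      Sum.elim ((A + B * h) *ᵥ v) ((C + D * h) *ᵥ v) := by
  simp [graphLin, Matrix.fromBlocks_mulVec, Matrix.add_mulVec, Function.comp_def]

/-- if `A + B·h` is invertible, the block matrix `M = fromBlocks A B C D`
maps the graph `Γ_h` onto the graph of `h' = (C + D·h)·(A + B·h)⁻¹`. -/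
theorem blockMatrix_map_graph {K : Type*} [Field K] {n : ℕ}
    (A B C D h : Matrix (Fin n) (Fin n) K) (hinv : IsUnit (A + B * h)) :
    Submodule.map (Matrix.fromBlocks A B C D).mulVecLin (graphSubspace h) =
      graphSubspace ((C + D * h) * (A + B * h)⁻¹) := by
  have hdet : IsUnit (A + B * h).det := (Matrix.isUnit_iff_isUnit_det _).mp hinv
  ext x
  simp only [graphSubspace, Submodule.mem_map, LinearMap.mem_range,
    exists_exists_eq_and, Matrix.mulVecLin_apply, fromBlocks_mulVec_graphLin]
  constructor
  · rintro ⟨v, rfl⟩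
    refine ⟨(A + B * h) *ᵥ v, ?_⟩
    simp [graphLin, Matrix.mulVec_mulVec, Matrix.mul_assoc, Matrix.nonsing_inv_mul _ hdet]
  · rintro ⟨w, rfl⟩
    refine ⟨(A + B * h)⁻¹ *ᵥ w, ?_⟩
    simp [graphLin, Matrix.mulVec_mulVec, Matrix.mul_nonsing_inv _ hdet]
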